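/- Let (Y,d) be a compact metric space and g : Y → Y a continuous surjection satisfying Axioms 1 and 2 with constants β > 0, integer K ≥ 1 and 0 < γ < 1, and fix ε' with 0 < ε' ≤ β/2 such that d̂(x,y) ≤ ε' implies d̂(ĝ^{−n}(x), ĝ^{−n}(y)) ≤ β for n = 0, 1, …, 2K−1. If y, z ∈ Ŷ^s(x, ε') for some x ∈ Ŷ, then d̂(ĝ(y), ĝ(z)) ≤ γ · d̂(y, z). -/

import Mathlib

open Metric Function Topology

variable {Y : Type*} [MetricSpace Y] [CompactSpace Y]

/-- The stationary inverse limit of `g : Y → Y`. -/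
abbrev InvLim (g : Y → Y) : Type _ :=
  {y : ℕ → Y // ∀ n : ℕ, y n = g (y (n + 1))}

/-- The induced map `ĝ` on the inverse limit. -/
def ghat (g : Y → Y) (y : InvLim g) : InvLim g :=
  ⟨fun n => g (y.1 n), fun n => congrArg g (y.2 n)⟩

/-- The inverse `ĝ⁻¹` of the induced map on the inverse limit. -/
def ghatInv (g : Y → Y) (y : InvLim g) : InvLim g :=
  ⟨fun n => y.1 (n + 1), fun n => y.2 (n + 1)⟩

/-- `d'(x,y) = sup_n γ^n d(x_n, y_n)`. -/
noncomputable def dp (g : Y → Y) (γ : ℝ) (x y : InvLim g) : ℝ :=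
  ⨆ n : ℕ, γ ^ n * dist (x.1 n) (y.1 n)

/-- `d̂(x,y) = ∑_{k=0}^{K-1} γ^{-k} d'(ĝ^{-k} x, ĝ^{-k} y)`. -/
noncomputable def dhat (g : Y → Y) (γ : ℝ) (K : ℕ) (x y : InvLim g) : ℝ :=
  ∑ k ∈ Finset.range K, (γ ^ k)⁻¹ * dp g γ ((ghatInv g)^[k] x) ((ghatInv g)^[k] y)

/-- Axiom 1: `d(x,y) ≤ β` implies `d(g^K x, g^K y) ≤ γ^K d(g^{2K} x, g^{2K} y)`. -/
def axiom1 (g : Y → Y) (β : ℝ) (K : ℕ) (γ : ℝ) : Prop :=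
  ∀ x y : Y, dist x y ≤ β →
    dist (g^[K] x) (g^[K] y) ≤ γ ^ K * dist (g^[2 * K] x) (g^[2 * K] y)

/-- Axiom 2: `g^K(B(g^K x, ε)) ⊆ g^{2K}(B(x, γ ε))` for `0 < ε ≤ β`. -/
def axiom2 (g : Y → Y) (β : ℝ) (K : ℕ) (γ : ℝ) : Prop :=
  ∀ x : Y, ∀ ε : ℝ, 0 < ε → ε ≤ β →
    g^[K] '' Metric.closedBall (g^[K] x) ε ⊆ g^[2 * K] '' Metric.closedBall x (γ * ε)

/-- The local stable set `Ŷ^s(x, ε)` in the inverse limit. -/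
def Shat (g : Y → Y) (γ : ℝ) (K : ℕ) (x : InvLim g) (ε : ℝ) : Set (InvLim g) :=
  {y | ∀ n : ℕ, dhat g γ K ((ghat g)^[n] x) ((ghat g)^[n] y) ≤ ε}

/-- The local unstable set `Ŷ^u(x, ε)` in the inverse limit. -/
def Uhat (g : Y → Y) (γ : ℝ) (K : ℕ) (x : InvLim g) (ε : ℝ) : Set (InvLim g) :=
  {y | ∀ n : ℕ, dhat g γ K ((ghatInv g)^[n] x) ((ghatInv g)^[n] y) ≤ ε}

theorem ghat_iter_val (g : Y → Y) (n : ℕ) (y : InvLim g) (i : ℕ) :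
    ((ghat g)^[n] y).1 i = g^[n] (y.1 i) := by
  induction n generalizing y with
  | zero => rfl
  | succ n ih => rw [iterate_succ_apply, ih, iterate_succ_apply]; rfl

theorem ghatInv_iter_val (g : Y → Y) (n : ℕ) (y : InvLim g) (i : ℕ) :
    ((ghatInv g)^[n] y).1 i = y.1 (i + n) := by
  induction n generalizing y with
  | zero => rfl
  | succ n ih =>
    rw [iterate_succ_apply, ih]
    change y.1 (i + n + 1) = _
    rfl

theorem invLim_iter (g : Y → Y) (n : ℕ) (y : InvLim g) (i : ℕ) :
    g^[n] (y.1 (i + n)) = y.1 i := by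
  induction n with
  | zero => rfl
  | succ n ih =>
    rw [iterate_succ_apply, ← Nat.add_assoc, ← y.2 (i + n), ih]

theorem dp_bdd (g : Y → Y) (γ : ℝ) (h0 : 0 < γ) (h1 : γ < 1) (x y : InvLim g) :
    BddAbove (Set.range fun n : ℕ => γ ^ n * dist (x.1 n) (y.1 n)) := by
  refine ⟨Metric.diam (Set.univ : Set Y), ?_⟩
  rintro _ ⟨n, rfl⟩
  have hd : dist (x.1 n) (y.1 n) ≤ Metric.diam (Set.univ : Set Y) :=
    Metric.dist_le_diam_of_mem isCompact_univ.isBounded (Set.mem_univ _) (Set.mem_univ _)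
  have hp : γ ^ n ≤ 1 := pow_le_one₀ h0.le h1.le
  exact (mul_le_of_le_one_left dist_nonneg hp).trans hd

theorem le_dp (g : Y → Y) (γ : ℝ) (h0 : 0 < γ) (h1 : γ < 1) (x y : InvLim g) (n : ℕ) :
    γ ^ n * dist (x.1 n) (y.1 n) ≤ dp g γ x y :=
  le_ciSup (dp_bdd g γ h0 h1 x y) n

theorem dp_nonneg (g : Y → Y) (γ : ℝ) (h0 : 0 < γ) (x y : InvLim g) : 0 ≤ dp g γ x y :=
  Real.iSup_nonneg fun n => by positivity

theorem dist_le_dhat (g : Y → Y) (γ : ℝ) (K : ℕ) (hK : 1 ≤ K) (h0 : 0 < γ) (h1 : γ < 1)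
    (x y : InvLim g) : dist (x.1 0) (y.1 0) ≤ dhat g γ K x y := by
  have h := Finset.single_le_sum
    (f := fun k => (γ ^ k)⁻¹ * dp g γ ((ghatInv g)^[k] x) ((ghatInv g)^[k] y))
    (s := Finset.range K)
    (fun k _ => mul_nonneg (by positivity) (dp_nonneg g γ h0 _ _))
    (Finset.mem_range.2 (by omega : 0 < K))
  have h' := le_dp g γ h0 h1 x y 0
  simp only [pow_zero, inv_one, one_mul, iterate_zero, id] at h h'
  exact h'.trans h

theorem eq_of_close (g : Y → Y) (β γ : ℝ) (K : ℕ) (hK : 1 ≤ K) (h0 : 0 < γ) (hγ1 : γ < 1)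
    (h1 : axiom1 g β K γ) (a b : Y) (h : ∀ n : ℕ, dist (g^[n] a) (g^[n] b) ≤ β) :
    g^[K] a = g^[K] b := by
  have key : ∀ m : ℕ, dist (g^[K] a) (g^[K] b)
      ≤ (γ ^ K) ^ m * dist (g^[K + m * K] a) (g^[K + m * K] b) := by
    intro m
    induction m with
    | zero => simp
    | succ m ih =>
      have := h1 _ _ (h (m * K))
      rw [← iterate_add_apply, ← iterate_add_apply, ← iterate_add_apply, ← iterate_add_apply]
        at this
      rw [show K + (m + 1) * K = 2 * K + m * K by ring, pow_succ, mul_assoc]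
      exact ih.trans (mul_le_mul_of_nonneg_left this (by positivity))
  have hlt : γ ^ K < 1 := pow_lt_one₀ h0.le hγ1 (by omega)
  have ht : Filter.Tendsto (fun m : ℕ => (γ ^ K) ^ m * β) Filter.atTop (𝓝 (0 * β)) :=
    (tendsto_pow_atTop_nhds_zero_of_lt_one (by positivity) hlt).mul_const β
  rw [zero_mul] at ht
  have := ge_of_tendsto' ht fun m =>
    (key m).trans (mul_le_mul_of_nonneg_left (h _) (by positivity))
  exact dist_le_zero.1 this

/-- Corollary 3.3: contraction on local stable sets. -/
theorem stmt6 (g : Y → Y) (hgc : Continuous g) (hgs : Function.Surjective g)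
    (β γ : ℝ) (K : ℕ) (hβ : 0 < β) (hK : 1 ≤ K) (hγ0 : 0 < γ) (hγ1 : γ < 1)
    (h1 : axiom1 g β K γ) (h2 : axiom2 g β K γ)
    (ε' : ℝ) (hε'0 : 0 < ε') (hε'β : ε' ≤ β / 2)
    (hε' : ∀ x y : InvLim g, dhat g γ K x y ≤ ε' → ∀ n : ℕ, n < 2 * K →
      dhat g γ K ((ghatInv g)^[n] x) ((ghatInv g)^[n] y) ≤ β) :
    ∀ x y z : InvLim g, y ∈ Shat g γ K x ε' → z ∈ Shat g γ K x ε' →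
      dhat g γ K (ghat g y) (ghat g z) ≤ γ * dhat g γ K y z := by
  intro x y z hy hz
  have main : ∀ w : InvLim g, w ∈ Shat g γ K x ε' → x.1 (K - 1) = w.1 (K - 1) := by
    intro w hw
    have h := eq_of_close g β γ K hK hγ0 hγ1 h1 (x.1 (K - 1 + K)) (w.1 (K - 1 + K)) (by
      intro n
      have ha := (dist_le_dhat g γ K hK hγ0 hγ1 _ _).trans
        (hε' _ _ (hw n) (K - 1 + K) (by omega))
      simpa only [ghatInv_iter_val, ghat_iter_val, Nat.zero_add] using ha)
    rwa [invLim_iter, invLim_iter] at h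
  have hyz : y.1 (K - 1) = z.1 (K - 1) := (main y hy).symm.trans (main z hz)
  have hlow : ∀ i, i ≤ K - 1 → y.1 i = z.1 i := by
    intro i hi
    have hy' := invLim_iter g (K - 1 - i) y i
    have hz' := invLim_iter g (K - 1 - i) z i
    rw [Nat.add_sub_cancel' hi] at hy' hz'
    rw [← hy', ← hz', hyz]
  unfold dhat
  rw [Finset.mul_sum]
  apply Finset.sum_le_sum
  intro k hk
  have hk' : k ≤ K - 1 := by have := Finset.mem_range.1 hk; omega
  have hdp : dp g γ ((ghatInv g)^[k] (ghat g y)) ((ghatInv g)^[k] (ghat g z))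
      ≤ γ * dp g γ ((ghatInv g)^[k] y) ((ghatInv g)^[k] z) := by
    have hnn := mul_nonneg hγ0.le (dp_nonneg g γ hγ0 ((ghatInv g)^[k] y) ((ghatInv g)^[k] z))
    apply ciSup_le
    intro n
    rw [ghatInv_iter_val, ghatInv_iter_val]
    change γ ^ n * dist (g (y.1 (n + k))) (g (z.1 (n + k))) ≤ _
    cases n with
    | zero =>
      rw [Nat.zero_add, hlow k hk', dist_self, mul_zero]
      exact hnn
    | succ m =>
      have e : m + 1 + k = (m + k) + 1 := by omega
      rw [e, ← y.2 (m + k), ← z.2 (m + k), pow_succ', mul_assoc]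
      have h := le_dp g γ hγ0 hγ1 ((ghatInv g)^[k] y) ((ghatInv g)^[k] z) m
      rw [ghatInv_iter_val, ghatInv_iter_val] at h
      exact mul_le_mul_of_nonneg_left h hγ0.le
  calc _ ≤ (γ ^ k)⁻¹ * (γ * dp g γ ((ghatInv g)^[k] y) ((ghatInv g)^[k] z)) :=
        mul_le_mul_of_nonneg_left hdp (by positivity)
    _ = _ := by ring
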